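/- arXiv:2106.08860 — 4 statements merged into one kernel-verified Lean document; each statement's English description precedes it below -/
import Mathlib

section
/- The following are equivalent: (1) (a,b) ∈ W₂; (2) there exist R > 0, a sequence t_i → ∞, and vectors v_i ∈ ℤ³ \ {0} such that sup_{s∈I} ‖g_{t_i}φ_{a,b}(s)v_i‖ ≤ R for all i. -/
open MeasureTheory Matrix Filter Topology ENNReal

noncomputable section

/-- `g_t = diag(e^{2t}, e^{-t}, e^{-t})`. -/
def gmat (t : ℝ) : Matrix (Fin 3) (Fin 3) ℝ :=
  Matrix.diagonal ![Real.exp (2*t), Real.exp (-t), Real.exp (-t)]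

/-- `φ_{a,b}(s)`, the unipotent matrix with first row `(1, s, as+b)`. -/
def phimat (a b s : ℝ) : Matrix (Fin 3) (Fin 3) ℝ :=
  !![1, s, a*s+b; 0, 1, 0; 0, 0, 1]

/-- `sup_{s ∈ [s₁,s₂]} ‖g_t φ_{a,b}(s) v‖` for an integer vector `v`, where `ℝ³`
carries the supremum norm. -/
def supNormOrbit (a b s₁ s₂ t : ℝ) (v : Fin 3 → ℤ) : ℝ :=
  ⨆ s : Set.Icc s₁ s₂, ‖(gmat t * phimat a b (s : ℝ)).mulVec (fun i => (v i : ℝ))‖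

/-- `(a,b) ∈ W₂` : there exists `C > 0` such that the system
`|qb+p₁| ≤ C q⁻²`, `|qa+p₂| ≤ C q⁻²` has infinitely many solutions
`(p₁,p₂,q) ∈ ℤ × ℤ × ℤ₊`. -/
def W2 (a b : ℝ) : Prop :=
  ∃ C > (0:ℝ), {x : ℤ × ℤ × ℤ | 0 < x.2.2 ∧
    |(x.2.2 : ℝ) * b + (x.1 : ℝ)| ≤ C / (x.2.2 : ℝ) ^ 2 ∧
    |(x.2.2 : ℝ) * a + (x.2.1 : ℝ)| ≤ C / (x.2.2 : ℝ) ^ 2}.Infinite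

theorem aux_norm_le (a b s t r : ℝ) (hr : 0 ≤ r) (v : Fin 3 → ℤ) :
    ‖(gmat t * phimat a b s).mulVec (fun i => (v i : ℝ))‖ ≤ r ↔
      Real.exp (2*t) * |((v 2 : ℝ) * b + v 0) + s * ((v 2 : ℝ) * a + v 1)| ≤ r ∧
      Real.exp (-t) * |(v 1 : ℝ)| ≤ r ∧ Real.exp (-t) * |(v 2 : ℝ)| ≤ r := by
  rw [pi_norm_le_iff_of_nonneg hr, Fin.forall_fin_succ, Fin.forall_fin_succ,
    Fin.forall_fin_succ]
  have e0 : (gmat t * phimat a b s).mulVec (fun i => (v i : ℝ)) 0 =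
      Real.exp (2*t) * (((v 2 : ℝ) * b + v 0) + s * ((v 2 : ℝ) * a + v 1)) := by
    simp [gmat, phimat, Matrix.mulVec, dotProduct, Fin.sum_univ_three, Matrix.diagonal_mul]
    ring
  have e1 : (gmat t * phimat a b s).mulVec (fun i => (v i : ℝ)) 1 =
      Real.exp (-t) * (v 1 : ℝ) := by
    simp [gmat, phimat, Matrix.mulVec, dotProduct, Fin.sum_univ_three, Matrix.diagonal_mul]
  have e2 : (gmat t * phimat a b s).mulVec (fun i => (v i : ℝ)) 2 =
      Real.exp (-t) * (v 2 : ℝ) := by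
    simp [gmat, phimat, Matrix.mulVec, dotProduct, Fin.sum_univ_three, Matrix.diagonal_mul]
  have h1 : (Fin.succ 0 : Fin 3) = 1 := rfl
  have h2 : (Fin.succ (Fin.succ 0) : Fin 3) = 2 := rfl
  rw [h1, h2, e0, e1, e2]
  simp only [Real.norm_eq_abs, abs_mul, Real.abs_exp]
  simp

theorem aux_bdd (a b s₁ s₂ t : ℝ) (v : Fin 3 → ℤ) :
    BddAbove (Set.range (fun s : Set.Icc s₁ s₂ =>
      ‖(gmat t * phimat a b (s : ℝ)).mulVec (fun i => (v i : ℝ))‖)) := by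
  refine (isCompact_range ?_).bddAbove
  apply Continuous.norm
  apply Continuous.matrix_mulVec _ continuous_const
  apply Continuous.matrix_mul continuous_const
  refine continuous_matrix fun i j => ?_
  fin_cases i <;> fin_cases j <;> simp [phimat] <;> fun_prop

theorem aux_unbdd (a b C : ℝ) (hC : 0 < C)
    (hinf : {x : ℤ × ℤ × ℤ | 0 < x.2.2 ∧
    |(x.2.2 : ℝ) * b + (x.1 : ℝ)| ≤ C / (x.2.2 : ℝ) ^ 2 ∧
    |(x.2.2 : ℝ) * a + (x.2.1 : ℝ)| ≤ C / (x.2.2 : ℝ) ^ 2}.Infinite) (N : ℕ) :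
    ∃ x : ℤ × ℤ × ℤ, (N : ℤ) < x.2.2 ∧ 0 < x.2.2 ∧
    |(x.2.2 : ℝ) * b + (x.1 : ℝ)| ≤ C / (x.2.2 : ℝ) ^ 2 ∧
    |(x.2.2 : ℝ) * a + (x.2.1 : ℝ)| ≤ C / (x.2.2 : ℝ) ^ 2 := by
  by_contra hcon
  push Not at hcon
  apply hinf
  obtain ⟨M, hM⟩ := exists_nat_ge (N * (|a| + |b|) + C)
  apply Set.Finite.subset (((Set.finite_Icc (-(M:ℤ)) M).prod
    ((Set.finite_Icc (-(M:ℤ)) M).prod (Set.finite_Icc (0:ℤ) N))))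
  rintro ⟨p, p', q⟩ ⟨hq, h1, h2⟩
  have hqN : q ≤ N := by
    by_contra hlt
    push Not at hlt
    exact absurd h2 (not_le.mpr (hcon _ hlt hq h1))
  simp only at hq h1 h2
  have hq1 : (1:ℝ) ≤ q := by exact_mod_cast hq
  have hqNr : (q:ℝ) ≤ N := by exact_mod_cast hqN
  have hCq : C / (q:ℝ)^2 ≤ C := div_le_self hC.le (one_le_pow₀ hq1)
  have key : ∀ (c : ℝ) (p : ℤ), |c| ≤ |a| + |b| → |(q:ℝ) * c + p| ≤ C / (q:ℝ)^2 →
      -(M:ℤ) ≤ p ∧ p ≤ M := by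
    intro c p hc hp
    have h3 : |(q:ℝ) * c| ≤ N * (|a| + |b|) := by
      rw [abs_mul, abs_of_pos (by linarith : (0:ℝ) < q)]
      gcongr
    have h4 := abs_le.mp h3
    have h5 := abs_le.mp hp
    constructor
    · have : (-(M:ℝ)) ≤ p := by linarith [h4.2, h5.1]
      exact_mod_cast this
    · have : (p:ℝ) ≤ M := by linarith [h4.1, h5.2]
      exact_mod_cast this
  exact ⟨key b p (by linarith [abs_nonneg a]) h1, key a p' (by linarith [abs_nonneg b]) h2,
    hq.le, hqN⟩

theorem aux_forward (a b s₁ s₂ : ℝ) (h : s₁ < s₂) (hW : W2 a b) :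
      ∃ R > (0:ℝ), ∃ (t : ℕ → ℝ) (v : ℕ → Fin 3 → ℤ),
        Tendsto t atTop atTop ∧ (∀ i, v i ≠ 0) ∧
        ∀ i, supNormOrbit a b s₁ s₂ (t i) (v i) ≤ R := by
  obtain ⟨C, hC, hinf⟩ := hW
  choose x hx using aux_unbdd a b C hC hinf
  have hCs : 0 ≤ C * (|s₁| + |s₂|) := by positivity
  refine ⟨C + C * (|s₁| + |s₂|) + |a| + 1, by positivity,
    fun i => Real.log ((x i).2.2 : ℝ), fun i => ![(x i).1, (x i).2.1, (x i).2.2], ?_, ?_, ?_⟩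
  · apply Real.tendsto_log_atTop.comp
    apply tendsto_atTop_mono _ tendsto_natCast_atTop_atTop
    intro i
    exact_mod_cast (hx i).1.le
  · intro i hi
    have := congrFun hi 2
    have h2 := (hx i).2.1
    simp at this
    omega
  · intro i
    have : Nonempty (Set.Icc s₁ s₂) := ⟨⟨s₁, le_rfl, h.le⟩⟩
    apply ciSup_le
    rintro ⟨s, hs⟩
    obtain ⟨-, hq, h1, h2⟩ := hx i
    rw [aux_norm_le _ _ _ _ _ (by positivity)]
    simp only [Matrix.cons_val]
    generalize x i = y at *
    obtain ⟨p, p', q⟩ := y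
    simp only at *
    have hq1 : (1:ℝ) ≤ q := by exact_mod_cast hq
    have hq0 : (0:ℝ) < q := by linarith
    have hCq : C / (q:ℝ)^2 ≤ C := div_le_self hC.le (one_le_pow₀ hq1)
    have hsabs : |s| ≤ |s₁| + |s₂| := by
      apply abs_le.mpr
      constructor
      · linarith [hs.1, neg_abs_le s₁, abs_nonneg s₂]
      · linarith [hs.2, le_abs_self s₂, abs_nonneg s₁]
    have ex1 : Real.exp (-Real.log q) = (q:ℝ)⁻¹ := by rw [Real.exp_neg, Real.exp_log hq0]
    have ex2 : Real.exp (2 * Real.log q) = (q:ℝ)^2 := by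
      rw [mul_comm, Real.exp_mul, Real.exp_log hq0]; norm_num
    rw [ex1, ex2]
    refine ⟨?_, ?_, ?_⟩
    · have : |((q : ℝ) * b + p) + s * ((q : ℝ) * a + p')| ≤
          C / (q:ℝ)^2 + (|s₁| + |s₂|) * (C / (q:ℝ)^2) := by
        refine (abs_add_le _ _).trans ?_
        rw [abs_mul]
        gcongr
      calc _ ≤ (q:ℝ)^2 * (C / (q:ℝ)^2 + (|s₁| + |s₂|) * (C / (q:ℝ)^2)) := by gcongr
        _ = C + C * (|s₁| + |s₂|) := by field_simp
        _ ≤ _ := by linarith [abs_nonneg a]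
    · rw [inv_mul_le_iff₀ hq0]
      have h3 : |(p':ℝ)| ≤ C + q * |a| := by
        have : (p':ℝ) = ((q:ℝ) * a + p') - q * a := by ring
        rw [this]
        refine (abs_sub _ _).trans ?_
        rw [abs_mul (q:ℝ) a, abs_of_pos hq0]
        linarith
      nlinarith [abs_nonneg a]
    · rw [abs_of_pos hq0, inv_mul_cancel₀ hq0.ne']
      linarith [abs_nonneg a]

theorem aux_exact (a b C : ℝ) (hC : 0 < C) (p p' q : ℤ) (hq : 0 < q)
    (h1 : (q:ℝ) * b + p = 0) (h2 : (q:ℝ) * a + p' = 0) :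
    {x : ℤ × ℤ × ℤ | 0 < x.2.2 ∧
    |(x.2.2 : ℝ) * b + (x.1 : ℝ)| ≤ C / (x.2.2 : ℝ) ^ 2 ∧
    |(x.2.2 : ℝ) * a + (x.2.1 : ℝ)| ≤ C / (x.2.2 : ℝ) ^ 2}.Infinite := by
  apply Set.infinite_of_injective_forall_mem
    (f := fun n : ℕ => (((n:ℤ)+1) * p, ((n:ℤ)+1) * p', ((n:ℤ)+1) * q))
  · intro m n hmn
    simp only [Prod.mk.injEq] at hmn
    have := mul_right_cancel₀ hq.ne' hmn.2.2
    omega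
  · intro n
    refine ⟨by simp only; positivity, ?_, ?_⟩
    · have : ((((n:ℤ)+1) * q : ℤ) : ℝ) * b + ((((n:ℤ)+1) * p : ℤ) : ℝ) = 0 := by
        push_cast; linear_combination ((n:ℝ)+1) * h1
      simp only [this, abs_zero]; positivity
    · have : ((((n:ℤ)+1) * q : ℤ) : ℝ) * a + ((((n:ℤ)+1) * p' : ℤ) : ℝ) = 0 := by
        push_cast; linear_combination ((n:ℝ)+1) * h2
      simp only [this, abs_zero]; positivity

theorem aux_backward (a b s₁ s₂ : ℝ) (h : s₁ < s₂)
    (hR : ∃ R > (0:ℝ), ∃ (t : ℕ → ℝ) (v : ℕ → Fin 3 → ℤ),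
        Tendsto t atTop atTop ∧ (∀ i, v i ≠ 0) ∧
        ∀ i, supNormOrbit a b s₁ s₂ (t i) (v i) ≤ R) : W2 a b := by
  obtain ⟨R, hR, t, v, ht, hv, hs⟩ := hR
  have hd : 0 < s₂ - s₁ := sub_pos.mpr h
  obtain ⟨K, hK, hK1, hK2⟩ : ∃ K > (0:ℝ), 2 * R / (s₂ - s₁) ≤ K ∧
      R + |s₁| * (2 * R / (s₂ - s₁)) ≤ K := by
    have : 0 < 2 * R / (s₂ - s₁) := by positivity
    refine ⟨2 * R / (s₂ - s₁) + (R + |s₁| * (2 * R / (s₂ - s₁))), by positivity, ?_, by linarith⟩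
    have : 0 ≤ |s₁| * (2 * R / (s₂ - s₁)) := by positivity
    linarith
  -- basic estimates, with the sign of `q` normalised away
  have est : ∀ i, |((v i 2 : ℝ)) * b + v i 0| ≤ K * Real.exp (-(2 * t i)) ∧
      |((v i 2 : ℝ)) * a + v i 1| ≤ K * Real.exp (-(2 * t i)) ∧
      |(v i 2 : ℝ)| ≤ R * Real.exp (t i) := by
    intro i
    have hle : ∀ s ∈ Set.Icc s₁ s₂,
        ‖(gmat (t i) * phimat a b s).mulVec (fun j => (v i j : ℝ))‖ ≤ R := fun s hs' =>
      (le_ciSup (aux_bdd a b s₁ s₂ (t i) (v i)) ⟨s, hs'⟩).trans (hs i)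
    obtain ⟨A1, -, A3⟩ := (aux_norm_le _ _ _ _ _ hR.le _).mp (hle s₁ ⟨le_rfl, h.le⟩)
    obtain ⟨B1, -, -⟩ := (aux_norm_le _ _ _ _ _ hR.le _).mp (hle s₂ ⟨h.le, le_rfl⟩)
    set X := (v i 2 : ℝ) * b + v i 0
    set Y := (v i 2 : ℝ) * a + v i 1
    have hE : 0 < Real.exp (2 * t i) := Real.exp_pos _
    have hA : |X + s₁ * Y| ≤ R * Real.exp (-(2 * t i)) := by
      rw [Real.exp_neg, ← div_eq_mul_inv, le_div_iff₀ hE]; linarith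
    have hB : |X + s₂ * Y| ≤ R * Real.exp (-(2 * t i)) := by
      rw [Real.exp_neg, ← div_eq_mul_inv, le_div_iff₀ hE]; linarith
    set E := Real.exp (-(2 * t i))
    have hE' : 0 < E := Real.exp_pos _
    have hY : |Y| ≤ 2 * R / (s₂ - s₁) * E := by
      have : (s₂ - s₁) * |Y| ≤ 2 * R * E := by
        rw [← abs_of_pos hd, ← abs_mul]
        have : (s₂ - s₁) * Y = (X + s₂ * Y) - (X + s₁ * Y) := by ring
        rw [this]
        refine (abs_sub _ _).trans ?_
        linarith
      rw [div_mul_eq_mul_div, le_div_iff₀ hd]; linarith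
    refine ⟨?_, ?_, ?_⟩
    · have : X = (X + s₁ * Y) - s₁ * Y := by ring
      rw [this]
      refine (abs_sub _ _).trans ?_
      rw [abs_mul]
      calc _ ≤ R * E + |s₁| * (2 * R / (s₂ - s₁) * E) := by gcongr
        _ = (R + |s₁| * (2 * R / (s₂ - s₁))) * E := by ring
        _ ≤ _ := by gcongr
    · exact hY.trans (by gcongr)
    · rw [Real.exp_neg, inv_mul_le_iff₀ (Real.exp_pos _)] at A3
      linarith
  have htend : Tendsto (fun i => K * Real.exp (-(2 * t i))) atTop (𝓝 0) := by
    have h1 : Tendsto (fun i => -(2 * t i)) atTop atBot :=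
      tendsto_neg_atTop_atBot.comp (ht.const_mul_atTop (by norm_num))
    simpa using (Real.tendsto_exp_atBot.comp h1).const_mul K
  have hKR : 0 < K * R^2 := by positivity
  have hnz : ∀ᶠ i in atTop, v i 2 ≠ 0 := by
    filter_upwards [htend.eventually (gt_mem_nhds one_pos)] with i hi h0
    obtain ⟨e1, e2, -⟩ := est i
    rw [h0] at e1 e2
    simp only [Int.cast_zero, zero_mul, zero_add] at e1 e2
    have f1 : |v i 0| < 1 := by exact_mod_cast e1.trans_lt hi
    have f2 : |v i 1| < 1 := by exact_mod_cast e2.trans_lt hi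
    apply hv i
    funext j
    fin_cases j
    · exact Int.abs_lt_one_iff.mp f1
    · exact Int.abs_lt_one_iff.mp f2
    · exact h0
  -- sign-normalised vectors
  have norm : ∀ i, v i 2 ≠ 0 → ∃ x : ℤ × ℤ × ℤ, 0 < x.2.2 ∧
      |(x.2.2 : ℝ) * b + (x.1 : ℝ)| ≤ K * Real.exp (-(2 * t i)) ∧
      |(x.2.2 : ℝ) * a + (x.2.1 : ℝ)| ≤ K * Real.exp (-(2 * t i)) ∧
      (x.2.2 : ℝ) ≤ R * Real.exp (t i) := by
    intro i hi
    obtain ⟨e1, e2, e3⟩ := est i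
    rcases lt_or_gt_of_ne hi with hi | hi
    · refine ⟨(-v i 0, -v i 1, -v i 2), by simpa using hi, ?_, ?_, ?_⟩
      · rw [← abs_neg] at e1
        convert e1 using 2; push_cast; ring
      · rw [← abs_neg] at e2
        convert e2 using 2; push_cast; ring
      · push_cast; exact (neg_le_abs _).trans e3
    · exact ⟨(v i 0, v i 1, v i 2), hi, e1, e2, (le_abs_self _).trans e3⟩
  refine ⟨K * R^2, hKR, ?_⟩
  by_cases hex : ∃ p p' q : ℤ, 0 < q ∧ (q:ℝ) * b + p = 0 ∧ (q:ℝ) * a + p' = 0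
  · obtain ⟨p, p', q, hq, h1, h2⟩ := hex
    exact aux_exact a b _ hKR p p' q hq h1 h2
  intro hfin
  have hev : ∀ x ∈ {x : ℤ × ℤ × ℤ | 0 < x.2.2 ∧
    |(x.2.2 : ℝ) * b + (x.1 : ℝ)| ≤ K * R^2 / (x.2.2 : ℝ) ^ 2 ∧
    |(x.2.2 : ℝ) * a + (x.2.1 : ℝ)| ≤ K * R^2 / (x.2.2 : ℝ) ^ 2}, ∀ᶠ i in atTop,
      ¬ (|(x.2.2 : ℝ) * b + (x.1 : ℝ)| ≤ K * Real.exp (-(2 * t i)) ∧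
        |(x.2.2 : ℝ) * a + (x.2.1 : ℝ)| ≤ K * Real.exp (-(2 * t i))) := by
    rintro ⟨p, p', q⟩ ⟨hq, -, -⟩
    simp only at hq ⊢
    by_cases h1 : (q:ℝ) * b + p = 0
    · have h2 : (q:ℝ) * a + p' ≠ 0 := fun h2 => hex ⟨p, p', q, hq, h1, h2⟩
      filter_upwards [htend.eventually (gt_mem_nhds (abs_pos.mpr h2))] with i hi hc
      exact absurd hc.2 (not_le.mpr hi)
    · filter_upwards [htend.eventually (gt_mem_nhds (abs_pos.mpr h1))] with i hi hc
      exact absurd hc.1 (not_le.mpr hi)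
  have hall := (Filter.eventually_all_finite hfin).mpr hev
  obtain ⟨i, hi1, hi2⟩ := (hall.and hnz).exists
  obtain ⟨x, hq, h1, h2, h3⟩ := norm i hi2
  have hq0 : (0:ℝ) < x.2.2 := by exact_mod_cast hq
  have hbound : K * Real.exp (-(2 * t i)) ≤ K * R^2 / (x.2.2 : ℝ)^2 := by
    rw [le_div_iff₀ (by positivity)]
    calc _ ≤ K * Real.exp (-(2 * t i)) * (R * Real.exp (t i))^2 := by gcongr
      _ = K * R^2 * (Real.exp (-(2 * t i)) * (Real.exp (t i) * Real.exp (t i))) := by ring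
      _ = K * R^2 := by
        rw [← Real.exp_add, ← Real.exp_add,
          show -(2 * t i) + (t i + t i) = 0 by ring, Real.exp_zero, mul_one]
  exact hi1 x ⟨hq, h1.trans hbound, h2.trans hbound⟩ ⟨h1, h2⟩

/-- **Lemma (Diophantine interpretation of `W₂`).** `(a,b) ∈ W₂` iff there exist
`R > 0`, a sequence `t_i → ∞`, and nonzero integer vectors `v_i` with
`sup_{s∈I} ‖g_{t_i} φ_{a,b}(s) v_i‖ ≤ R` for all `i`. -/
theorem mem_W2_iff_bounded_orbit (a b s₁ s₂ : ℝ) (h : s₁ < s₂) :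
    W2 a b ↔
      ∃ R > (0:ℝ), ∃ (t : ℕ → ℝ) (v : ℕ → Fin 3 → ℤ),
        Tendsto t atTop atTop ∧ (∀ i, v i ≠ 0) ∧
        ∀ i, supNormOrbit a b s₁ s₂ (t i) (v i) ≤ R := by
  exact ⟨aux_forward a b s₁ s₂ h, aux_backward a b s₁ s₂ h⟩
end
end

section
/- The following are equivalent: (1) (a,b) ∈ ℚ²; (2) there exists v ∈ ℤ³ \ {0} such that sup_{s∈I} ‖g_tφ_{a,b}(s)v‖ → 0 as t → ∞; (3) there exists R > 0 such that for every sufficiently large t > 0 there exists v ∈ ℤ³ \ {0} with sup_{s∈I} ‖g_tφ_{a,b}(s)v‖ ≤ R. -/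
open MeasureTheory Matrix Filter Topology ENNReal

noncomputable section

lemma orbit_vec (a b s t : ℝ) (v : Fin 3 → ℤ) :
    (gmat t * phimat a b s).mulVec (fun i => (v i : ℝ)) =
      ![Real.exp (2*t) * ((v 0 + b * v 2) + s * (v 1 + a * v 2)),
        Real.exp (-t) * v 1, Real.exp (-t) * v 2] := by
  rw [gmat, phimat, ← Matrix.mulVec_mulVec]
  funext i
  rw [Matrix.mulVec_diagonal]
  fin_cases i <;> simp [Matrix.mulVec, dotProduct, Fin.sum_univ_three]
  ring

lemma orbit_le (a b s₁ s₂ t : ℝ) (v : Fin 3 → ℤ) (s : ℝ) (hs : s ∈ Set.Icc s₁ s₂) :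
    ‖(gmat t * phimat a b s).mulVec (fun i => (v i : ℝ))‖ ≤ supNormOrbit a b s₁ s₂ t v := by
  unfold supNormOrbit
  refine le_ciSup (f := fun s : Set.Icc s₁ s₂ =>
    ‖(gmat t * phimat a b (s : ℝ)).mulVec (fun i => (v i : ℝ))‖) ?_ ⟨s, hs⟩
  apply IsCompact.bddAbove
  apply isCompact_range
  apply Continuous.norm
  simp only [orbit_vec]
  apply continuous_pi
  intro i
  fin_cases i <;> simp <;> fun_prop

lemma rat_of_approx (α C R : ℝ) (hC : 0 ≤ C) (hR : 0 ≤ R)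
    (H : ∀ᶠ t : ℝ in atTop, ∃ z y : ℤ, z ≠ 0 ∧ |(z:ℝ)| ≤ R * Real.exp t ∧
      |y + α * z| ≤ C * Real.exp (-(2*t))) : ∃ p : ℚ, α = p := by
  have H1 : ∀ᶠ t : ℝ in atTop, (2 * C * R * Real.exp 1) * Real.exp (-t) < 1 := by
    have := (Real.tendsto_exp_neg_atTop_nhds_zero).const_mul (2 * C * R * Real.exp 1)
    rw [mul_zero] at this
    exact this.eventually_lt_const one_pos
  obtain ⟨T, hT⟩ := eventually_atTop.1 (H.and H1)
  have hT' : ∀ n : ℕ, T ≤ T + n := fun n => by simp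
  choose z y hz hzR hy using fun n : ℕ => (hT (T + n) (hT' n)).1
  have hstep : ∀ n, y n * z (n+1) = y (n+1) * z n := by
    intro n
    have h1 := (hT (T + n) (hT' n)).2
    have hz1 := hzR n
    have hz2 := hzR (n+1)
    have hy1 := hy n
    have hy2 := hy (n+1)
    set u := T + (n:ℝ) with hu
    have hu' : T + ((n+1 : ℕ) : ℝ) = u + 1 := by push_cast; rw [hu]; ring
    rw [hu'] at hz2 hy2
    have e1 : Real.exp (-(2*u)) * Real.exp (u+1) = Real.exp 1 * Real.exp (-u) := by
      rw [← Real.exp_add, ← Real.exp_add]; ring_nf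
    have e2 : Real.exp (-(2*(u+1))) * Real.exp u ≤ Real.exp 1 * Real.exp (-u) := by
      rw [← Real.exp_add, ← Real.exp_add]; apply Real.exp_le_exp.2; linarith
    have k1 : |(y n + α * z n) * z (n+1)| ≤ C * R * (Real.exp 1 * Real.exp (-u)) := by
      rw [abs_mul, ← e1]
      calc _ ≤ (C * Real.exp (-(2*u))) * (R * Real.exp (u+1)) := by gcongr
        _ = _ := by ring
    have k2 : |(y (n+1) + α * z (n+1)) * z n| ≤ C * R * (Real.exp 1 * Real.exp (-u)) := by
      rw [abs_mul]
      calc _ ≤ (C * Real.exp (-(2*(u+1)))) * (R * Real.exp u) := by gcongr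
        _ = C * R * (Real.exp (-(2*(u+1))) * Real.exp u) := by ring
        _ ≤ _ := by gcongr
    have k3 : |((y n * z (n+1) - y (n+1) * z n : ℤ) : ℝ)| < 1 := by
      have : ((y n * z (n+1) - y (n+1) * z n : ℤ) : ℝ) =
        (y n + α * z n) * z (n+1) - (y (n+1) + α * z (n+1)) * z n := by push_cast; ring
      rw [this]
      calc _ ≤ _ := abs_sub _ _
        _ ≤ _ := add_le_add k1 k2
        _ < 1 := by linarith
    have k4 : |y n * z (n+1) - y (n+1) * z n| < 1 := by exact_mod_cast k3
    have := Int.abs_lt_one_iff.1 k4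
    linarith
  have hzr : ∀ n, (z n : ℝ) ≠ 0 := fun n => by exact_mod_cast hz n
  have hconst : ∀ n, (y n : ℝ) / z n = y 0 / z 0 := by
    intro n
    induction n with
    | zero => rfl
    | succ n ih =>
      rw [← ih, div_eq_div_iff (hzr _) (hzr _)]
      exact_mod_cast (hstep n).symm
  refine ⟨-((y 0 : ℚ) / z 0), ?_⟩
  push_cast
  have hb : ∀ n : ℕ, |α + y 0 / z 0| ≤ C * Real.exp (-(2*(T + n))) := by
    intro n
    rw [← hconst n]
    refine le_trans ?_ (hy n)
    have : (y n : ℝ) + α * z n = (α + y n / z n) * z n := by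
      have := hzr n
      field_simp; ring
    rw [this, abs_mul]
    have h1 : (1:ℝ) ≤ |(z n : ℝ)| := by exact_mod_cast Int.one_le_abs (hz n)
    exact le_mul_of_one_le_right (abs_nonneg _) h1
  have hlim : Tendsto (fun n : ℕ => C * Real.exp (-(2*(T + n)))) atTop (𝓝 0) := by
    rw [← mul_zero C]
    apply Filter.Tendsto.const_mul
    apply Real.tendsto_exp_neg_atTop_nhds_zero.comp
    apply Tendsto.const_mul_atTop two_pos
    exact tendsto_atTop_add_const_left _ _ tendsto_natCast_atTop_atTop
  have := ge_of_tendsto' hlim hb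
  have := abs_eq_zero.1 (le_antisymm this (abs_nonneg _))
  linarith

/-- **Lemma (characterization of rationality).** The following are equivalent:
(1) `(a,b) ∈ ℚ²`;
(2) there is `v ∈ ℤ³ \ {0}` with `sup_{s∈I} ‖g_t φ_{a,b}(s) v‖ → 0` as `t → ∞`;
(3) there is `R > 0` such that for every sufficiently large `t > 0` there is
`v ∈ ℤ³ \ {0}` with `sup_{s∈I} ‖g_t φ_{a,b}(s) v‖ ≤ R`. -/
theorem rational_tfae (a b s₁ s₂ : ℝ) (h : s₁ < s₂) :
    List.TFAE
      [ (∃ p q : ℚ, a = (p : ℝ) ∧ b = (q : ℝ)),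
        (∃ v : Fin 3 → ℤ, v ≠ 0 ∧
          Tendsto (fun t : ℝ => supNormOrbit a b s₁ s₂ t v) atTop (𝓝 0)),
        (∃ R > (0:ℝ), ∀ᶠ t : ℝ in atTop, 0 < t →
          ∃ v : Fin 3 → ℤ, v ≠ 0 ∧ supNormOrbit a b s₁ s₂ t v ≤ R) ] := by
  tfae_have 1 → 2 := by
    rintro ⟨p, q, rfl, rfl⟩
    refine ⟨![-(q.num * p.den), -(p.num * q.den), p.den * q.den], ?_, ?_⟩
    · intro h0
      have := congrFun h0 2
      simp at this
    · set v : Fin 3 → ℤ := ![-(q.num * p.den), -(p.num * q.den), p.den * q.den] with hv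
      have hp : (p:ℝ) * p.den = p.num := by exact_mod_cast Rat.mul_den_eq_num p
      have hq : (q:ℝ) * q.den = q.num := by exact_mod_cast Rat.mul_den_eq_num q
      have hA : (v 0 : ℝ) + q * v 2 = 0 := by
        simp [hv]; linear_combination (p.den : ℝ) * hq
      have hB : (v 1 : ℝ) + p * v 2 = 0 := by
        simp [hv]; linear_combination (q.den : ℝ) * hp
      have hlim := (Real.tendsto_exp_neg_atTop_nhds_zero).mul_const (|(v 1 : ℝ)| + |(v 2 : ℝ)|)
      rw [zero_mul] at hlim
      refine squeeze_zero (fun t => Real.iSup_nonneg fun s => norm_nonneg _) (fun t => ?_) hlim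
      refine Real.iSup_le (fun s => ?_) (by positivity)
      rw [orbit_vec, hA, hB, pi_norm_le_iff_of_nonneg (by positivity)]
      intro i
      have e := (Real.exp_pos (-t)).le
      have n1 := abs_nonneg (v 1 : ℝ)
      have n2 := abs_nonneg (v 2 : ℝ)
      fin_cases i
      · simp; positivity
      · simp only [Fin.mk_one, Matrix.cons_val_one, Matrix.cons_val_zero, Real.norm_eq_abs, abs_mul, Real.abs_exp]
        gcongr; linarith
      · simp only [Fin.reduceFinMk, Matrix.cons_val, Real.norm_eq_abs, abs_mul, Real.abs_exp]
        gcongr; linarith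
  tfae_have 2 → 3 := by
    rintro ⟨v, hv, hl⟩
    refine ⟨1, one_pos, ?_⟩
    filter_upwards [hl.eventually_lt_const one_pos] with t ht _
    exact ⟨v, hv, ht.le⟩
  tfae_have 3 → 1 := by
    rintro ⟨R, hR, H⟩
    have hd : 0 < s₂ - s₁ := by linarith
    set D := 2 * R / (s₂ - s₁) with hD
    have hD0 : 0 < D := by positivity
    set C := R + (1 + |s₁|) * D with hC
    have hC0 : 0 < C := by positivity
    have H1 : ∀ᶠ t : ℝ in atTop, C * Real.exp (-(2*t)) < 1 := by
      have := ((Real.tendsto_exp_neg_atTop_nhds_zero).comp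
        (tendsto_id.const_mul_atTop (two_pos (α := ℝ)))).const_mul C
      rw [mul_zero] at this
      exact this.eventually_lt_const one_pos
    have key : ∀ᶠ t : ℝ in atTop, ∃ z x y : ℤ, z ≠ 0 ∧ |(z:ℝ)| ≤ R * Real.exp t ∧
        |x + b * z| ≤ C * Real.exp (-(2*t)) ∧ |y + a * z| ≤ C * Real.exp (-(2*t)) := by
      filter_upwards [H, H1, eventually_gt_atTop 0] with t ht ht1 ht0
      obtain ⟨v, hv, hle⟩ := ht ht0
      have m1 := (orbit_le a b s₁ s₂ t v s₁ ⟨le_rfl, h.le⟩).trans hle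
      have m2 := (orbit_le a b s₁ s₂ t v s₂ ⟨h.le, le_rfl⟩).trans hle
      rw [orbit_vec, pi_norm_le_iff_of_nonneg hR.le] at m1 m2
      have a1 := m1 0
      have a2 := m2 0
      have a3 := m1 2
      simp only [Matrix.cons_val, Real.norm_eq_abs, abs_mul, Real.abs_exp] at a1 a2 a3
      set A : ℝ := v 0 + b * v 2 with hA
      set B : ℝ := v 1 + a * v 2 with hB
      have ee : Real.exp (2*t) * Real.exp (-(2*t)) = 1 := by rw [← Real.exp_add]; simp
      have ee' : Real.exp t * Real.exp (-t) = 1 := by rw [← Real.exp_add]; simp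
      have conv : ∀ w : ℝ, Real.exp (2*t) * w ≤ R → w ≤ R * Real.exp (-(2*t)) := by
        intro w hw
        have := mul_le_mul_of_nonneg_right hw (Real.exp_pos (-(2*t))).le
        calc w = Real.exp (2*t) * w * Real.exp (-(2*t)) := by linear_combination (-w) * ee
          _ ≤ _ := this
      have b1 := conv _ a1
      have b2 := conv _ a2
      have b3 : |(v 2 : ℝ)| ≤ R * Real.exp t := by
        have := mul_le_mul_of_nonneg_right a3 (Real.exp_pos t).le
        calc |(v 2 : ℝ)| = Real.exp (-t) * |(v 2 : ℝ)| * Real.exp t := by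
              linear_combination (-|(v 2 : ℝ)|) * ee'
          _ ≤ _ := this
      set E := Real.exp (-(2*t)) with hE
      have hE0 : 0 < E := Real.exp_pos _
      have c1 : |B| ≤ D * E := by
        have : (s₂ - s₁) * |B| ≤ 2 * R * E := by
          calc (s₂ - s₁) * |B| = |(A + s₂ * B) - (A + s₁ * B)| := by
                rw [← abs_of_pos hd, ← abs_mul]; ring_nf
            _ ≤ _ := abs_sub _ _
            _ ≤ _ := by linarith
        rw [hD, div_mul_eq_mul_div, le_div_iff₀ hd]
        linarith
      have c2 : |A| ≤ C * E := by
        calc |A| = |(A + s₁ * B) - s₁ * B| := by ring_nf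
          _ ≤ _ := abs_sub _ _
          _ ≤ R * E + |s₁| * (D * E) := by rw [abs_mul]; gcongr
          _ ≤ C * E := by
            have : 0 < D * E := by positivity
            rw [hC]; linarith
      have c3 : |B| ≤ C * E := by
        refine c1.trans ?_
        have : 0 ≤ |s₁| * D := by positivity
        gcongr
        rw [hC]; linarith
      refine ⟨v 2, v 0, v 1, ?_, b3, c2, c3⟩
      intro hz
      apply hv
      have d1 : v 0 = 0 := by
        apply Int.abs_lt_one_iff.1
        have : |(v 0 : ℝ)| < 1 := by
          have := c2.trans_lt ht1
          simpa [hA, hz] using this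
        exact_mod_cast this
      have d2 : v 1 = 0 := by
        apply Int.abs_lt_one_iff.1
        have : |(v 1 : ℝ)| < 1 := by
          have := c3.trans_lt ht1
          simpa [hB, hz] using this
        exact_mod_cast this
      funext i
      fin_cases i
      · exact d1
      · exact d2
      · exact hz
    obtain ⟨p, hp⟩ := rat_of_approx a C R hC0.le hR.le (key.mono fun t ⟨z, x, y, h1, h2, h3, h4⟩ =>
      ⟨z, y, h1, h2, h4⟩)
    obtain ⟨q, hq⟩ := rat_of_approx b C R hC0.le hR.le (key.mono fun t ⟨z, x, y, h1, h2, h3, h4⟩ =>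
      ⟨z, x, h1, h2, h3⟩)
    exact ⟨p, q, hp, hq⟩
  tfae_finish
end
end

section
/- (a,b) ∈ W₂^∞ if and only if there exist a sequence t_i → ∞ and vectors v_i ∈ ℤ³ \ {0} such that sup_{s∈I} ‖g_{t_i}φ_{a,b}(s)v_i‖ → 0 as i → ∞. -/
open MeasureTheory Matrix Filter Topology ENNReal

noncomputable section

/-- `(a,b) ∈ W₂^∞` : for every `C > 0` the system
`|qb+p₁| ≤ C q⁻²`, `|qa+p₂| ≤ C q⁻²` has a solution `(p₁,p₂,q) ∈ ℤ × ℤ × ℤ₊`. -/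
def W2inf (a b : ℝ) : Prop :=
  ∀ C > (0:ℝ), ∃ p₁ p₂ q : ℤ, 0 < q ∧
    |(q : ℝ) * b + (p₁ : ℝ)| ≤ C / (q : ℝ) ^ 2 ∧
    |(q : ℝ) * a + (p₂ : ℝ)| ≤ C / (q : ℝ) ^ 2

lemma orbit_norm_le_iff (a b s t : ℝ) (v : Fin 3 → ℤ) (M : ℝ) (hM : 0 ≤ M) :
    ‖(gmat t * phimat a b s).mulVec (fun i => (v i : ℝ))‖ ≤ M ↔
      Real.exp (2*t) * |((v 2 : ℝ) * b + v 0) + s * ((v 2 : ℝ) * a + v 1)| ≤ M ∧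
      Real.exp (-t) * |(v 1 : ℝ)| ≤ M ∧ Real.exp (-t) * |(v 2 : ℝ)| ≤ M := by
  rw [← Matrix.mulVec_mulVec, pi_norm_le_iff_of_nonneg hM, Fin.forall_fin_succ,
    Fin.forall_fin_succ, Fin.forall_fin_succ]
  have e : (1 * (v 0 : ℝ) + s * v 1 + (a*s+b) * v 2)
      = ((v 2 : ℝ) * b + v 0) + s * ((v 2 : ℝ) * a + v 1) := by ring
  have e0 : ((gmat t).mulVec ((phimat a b s).mulVec (fun i => (v i : ℝ)))) =
      ![Real.exp (2*t) * (((v 2 : ℝ) * b + v 0) + s * ((v 2 : ℝ) * a + v 1)),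
        Real.exp (-t) * v 1, Real.exp (-t) * v 2] := by
    rw [← e]
    funext i
    fin_cases i <;>
      simp [gmat, phimat, Matrix.mulVec_diagonal, Matrix.mulVec, dotProduct, Fin.sum_univ_three,
        Matrix.diagonal]
  rw [e0]
  simp [abs_mul, Real.abs_exp]

lemma orbit_bdd (a b s₁ s₂ t : ℝ) (v : Fin 3 → ℤ) :
    BddAbove (Set.range fun s : Set.Icc s₁ s₂ =>
      ‖(gmat t * phimat a b (s : ℝ)).mulVec (fun i => (v i : ℝ))‖) := by
  refine ⟨Real.exp (2*t) * (|(v 2 : ℝ) * b + v 0| + (|s₁| + |s₂|) * |(v 2 : ℝ) * a + v 1|)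
    + Real.exp (-t) * |(v 1 : ℝ)| + Real.exp (-t) * |(v 2 : ℝ)|, ?_⟩
  rintro _ ⟨⟨s, hs⟩, rfl⟩
  have h1 : 0 ≤ Real.exp (2*t) * (|(v 2 : ℝ) * b + v 0| + (|s₁| + |s₂|) * |(v 2 : ℝ) * a + v 1|) := by
    positivity
  have h2 : 0 ≤ Real.exp (-t) * |(v 1 : ℝ)| := by positivity
  have h3 : 0 ≤ Real.exp (-t) * |(v 2 : ℝ)| := by positivity
  have hs' : |s| ≤ |s₁| + |s₂| := by
    rw [abs_le]
    constructor
    · linarith [hs.1, neg_abs_le s₁, abs_nonneg s₂]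
    · linarith [hs.2, le_abs_self s₂, abs_nonneg s₁]
  refine (orbit_norm_le_iff a b s t v _ (by linarith)).2 ⟨?_, by linarith, by linarith⟩
  have : Real.exp (2*t) * |((v 2 : ℝ) * b + v 0) + s * ((v 2 : ℝ) * a + v 1)| ≤
      Real.exp (2*t) * (|(v 2 : ℝ) * b + v 0| + (|s₁| + |s₂|) * |(v 2 : ℝ) * a + v 1|) := by
    gcongr
    refine (abs_add_le _ _).trans ?_
    rw [abs_mul]
    gcongr
  linarith

lemma orbit_forward (a b s₁ s₂ : ℝ) (hW : W2inf a b) (ε : ℝ) (h0 : 0 < ε)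
    (h1 : ε ≤ 1) : ∃ (t : ℝ) (v : Fin 3 → ℤ), Real.log (1/ε) ≤ t ∧ v ≠ 0 ∧
      supNormOrbit a b s₁ s₂ t v ≤ (2 + |a| + |s₁| + |s₂|) * ε := by
  obtain ⟨p₁, p₂, q, hq, hb, ha⟩ := hW (ε^3) (by positivity)
  have hq1 : (1:ℝ) ≤ q := by exact_mod_cast hq
  have hq0 : (0:ℝ) < q := by linarith
  refine ⟨Real.log (q/ε), ![p₁, p₂, q], ?_, ?_, ?_⟩
  · apply Real.log_le_log (by positivity)
    gcongr
  · intro hv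
    have := congrFun hv 2
    simp at this
    omega
  · have hM : 0 ≤ (2 + |a| + |s₁| + |s₂|) * ε := by positivity
    refine Real.iSup_le ?_ hM
    rintro ⟨s, hs⟩
    have hs' : |s| ≤ |s₁| + |s₂| := by
      rw [abs_le]
      constructor
      · linarith [hs.1, neg_abs_le s₁, abs_nonneg s₂]
      · linarith [hs.2, le_abs_self s₂, abs_nonneg s₁]
    have hx : Real.exp (Real.log (q/ε)) = q/ε := Real.exp_log (by positivity)
    have hx2 : Real.exp (2 * Real.log (q/ε)) = (q/ε)^2 := by
      rw [two_mul, Real.exp_add, hx, sq]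
    have hxn : Real.exp (-Real.log (q/ε)) = ε/q := by
      rw [Real.exp_neg, hx, inv_div]
    refine (orbit_norm_le_iff a b s _ _ _ hM).2 ⟨?_, ?_, ?_⟩
    · rw [hx2]
      simp only [Matrix.cons_val]
      calc ((q:ℝ)/ε)^2 * |((q : ℝ) * b + p₁) + s * ((q : ℝ) * a + p₂)|
          ≤ ((q:ℝ)/ε)^2 * (ε^3/(q:ℝ)^2 + (|s₁| + |s₂|) * (ε^3/(q:ℝ)^2)) := by
            gcongr
            refine (abs_add_le _ _).trans ?_
            rw [abs_mul]
            gcongr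
        _ = (1 + |s₁| + |s₂|) * ε := by field_simp; ring
        _ ≤ _ := by gcongr; linarith [abs_nonneg a]
    · rw [hxn]
      simp only [Matrix.cons_val]
      have hp : |(p₂:ℝ)| ≤ q * (1 + |a|) := by
        have e : (p₂:ℝ) = ((q:ℝ) * a + p₂) + (-(q * a)) := by ring
        have h3 : ε^3/(q:ℝ)^2 ≤ q := by
          rw [div_le_iff₀ (by positivity)]
          have : ε^3 ≤ 1 := pow_le_one₀ h0.le h1
          have : (1:ℝ) ≤ q^3 := one_le_pow₀ hq1
          nlinarith
        calc |(p₂:ℝ)| = |((q:ℝ) * a + p₂) + (-(q * a))| := by rw [← e]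
          _ ≤ |(q:ℝ) * a + p₂| + |(-(q * a))| := abs_add_le _ _
          _ ≤ q + q * |a| := by
            rw [abs_neg, abs_mul, abs_of_pos hq0]; linarith
          _ = _ := by ring
      calc ε / q * |(p₂:ℝ)| ≤ ε / q * (q * (1 + |a|)) := by gcongr
        _ = (1 + |a|) * ε := by field_simp
        _ ≤ _ := by gcongr ?_ * ε; linarith [abs_nonneg s₁, abs_nonneg s₂]
    · rw [hxn]
      simp only [Matrix.cons_val]
      rw [abs_of_pos hq0, div_mul_cancel₀ _ hq0.ne']
      nlinarith [abs_nonneg a, abs_nonneg s₁, abs_nonneg s₂]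

lemma orbit_backward (a b s₁ s₂ : ℝ) (h : s₁ < s₂) (C : ℝ) (hC : 0 < C) :
    ∃ δ > 0, ∀ (t : ℝ) (v : Fin 3 → ℤ), 0 ≤ t → v ≠ 0 → supNormOrbit a b s₁ s₂ t v ≤ δ →
      ∃ p₁ p₂ q : ℤ, 0 < q ∧
    |(q : ℝ) * b + (p₁ : ℝ)| ≤ C / (q : ℝ) ^ 2 ∧
    |(q : ℝ) * a + (p₂ : ℝ)| ≤ C / (q : ℝ) ^ 2 := by
  have hd : 0 < s₂ - s₁ := by linarith
  obtain ⟨K, hK⟩ : ∃ K, K = 1 + (1 + |s₁|) * (2 / (s₂ - s₁)) := ⟨_, rfl⟩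
  have hK0 : 0 < K := by rw [hK]; positivity
  refine ⟨min 1 (min (C/K) (1/(2*K))), by positivity, ?_⟩
  intro t v ht hv hsup
  obtain ⟨δ, hδ⟩ : ∃ δ, δ = min 1 (min (C/K) (1/(2*K))) := ⟨_, rfl⟩
  rw [← hδ] at hsup
  have hδ0 : 0 < δ := by rw [hδ]; positivity
  have hδ1 : δ ≤ 1 := by rw [hδ]; exact min_le_left _ _
  have hδ2 : K * δ ≤ C := by
    have : δ ≤ C/K := by rw [hδ]; exact (min_le_right _ _).trans (min_le_left _ _)
    rw [le_div_iff₀ hK0] at this; linarith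
  have hδ3 : K * δ < 1 := by
    have : δ ≤ 1/(2*K) := by rw [hδ]; exact (min_le_right _ _).trans (min_le_right _ _)
    rw [le_div_iff₀ (by positivity)] at this; linarith
  have key : ∀ s ∈ Set.Icc s₁ s₂, _ := fun s hs =>
    (orbit_norm_le_iff a b s t v δ hδ0.le).1
      ((le_ciSup (orbit_bdd a b s₁ s₂ t v) ⟨s, hs⟩).trans hsup)
  obtain ⟨k1, -, k3⟩ := key s₁ ⟨le_rfl, h.le⟩
  obtain ⟨k2, -, -⟩ := key s₂ ⟨h.le, le_rfl⟩
  obtain ⟨A, hA⟩ : ∃ A, A = (v 2 : ℝ) * b + v 0 := ⟨_, rfl⟩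
  obtain ⟨B, hB⟩ : ∃ B, B = (v 2 : ℝ) * a + v 1 := ⟨_, rfl⟩
  rw [← hA, ← hB] at k1 k2
  obtain ⟨E, hE⟩ : ∃ E, E = Real.exp t := ⟨_, rfl⟩
  have hE1 : 1 ≤ E := by rw [hE]; exact Real.one_le_exp ht
  have hE0 : 0 < E := by linarith
  rw [two_mul, Real.exp_add, ← hE] at k1 k2
  rw [Real.exp_neg, ← hE, inv_mul_le_iff₀ hE0] at k3
  have l1 : |A + s₁ * B| ≤ δ / (E*E) := by rw [le_div_iff₀ (by positivity)]; linarith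
  have l2 : |A + s₂ * B| ≤ δ / (E*E) := by rw [le_div_iff₀ (by positivity)]; linarith
  have hη : 0 < δ / (E*E) := by positivity
  obtain ⟨η, hηe⟩ : ∃ η, η = δ / (E*E) := ⟨_, rfl⟩
  rw [← hηe] at l1 l2 hη
  have lB : |B| ≤ 2 / (s₂ - s₁) * η := by
    have : (s₂ - s₁) * |B| ≤ 2 * η := by
      calc (s₂ - s₁) * |B| = |(A + s₂ * B) - (A + s₁ * B)| := by
            rw [← abs_of_pos hd, ← abs_mul]; congr 1; ring
        _ ≤ |A + s₂ * B| + |A + s₁ * B| := abs_sub _ _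
        _ ≤ 2 * η := by linarith
    rw [div_mul_eq_mul_div, le_div_iff₀ hd]; linarith
  have lA : |A| ≤ η + |s₁| * (2 / (s₂ - s₁) * η) := by
    calc |A| = |(A + s₁ * B) - s₁ * B| := by congr 1; ring
      _ ≤ |A + s₁ * B| + |s₁ * B| := abs_sub _ _
      _ ≤ _ := by rw [abs_mul]; gcongr
  have hr : 0 < 2 / (s₂ - s₁) := by positivity
  have LB : |B| ≤ K * η := by
    rw [hK]
    have : 0 ≤ |s₁| * (2 / (s₂ - s₁) * η) := by positivity
    nlinarith
  have LA : |A| ≤ K * η := by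
    rw [hK]
    have : 0 ≤ (2 / (s₂ - s₁) * η) := by positivity
    nlinarith
  have hηδ : η ≤ δ := by
    rw [hηe]; apply div_le_self hδ0.le; nlinarith
  have hKη : K * η < 1 := lt_of_le_of_lt (by gcongr) hδ3
  have hq : v 2 ≠ 0 := by
    intro h2
    apply hv
    have hA' : |(v 0 : ℝ)| < 1 := by
      have : A = v 0 := by rw [hA, h2]; simp
      rw [← this]; linarith
    have hB' : |(v 1 : ℝ)| < 1 := by
      have : B = v 1 := by rw [hB, h2]; simp
      rw [← this]; linarith
    have h0 : v 0 = 0 := Int.abs_lt_one_iff.1 (by exact_mod_cast hA')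
    have h1 : v 1 = 0 := Int.abs_lt_one_iff.1 (by exact_mod_cast hB')
    funext i
    fin_cases i <;> simp [h0, h1, h2]
  have hqpos : 0 < |(v 2 : ℝ)| := by
    rw [abs_pos]; exact_mod_cast hq
  have fin : K * η ≤ C / (v 2 : ℝ)^2 := by
    rw [← sq_abs, le_div_iff₀ (by positivity), hηe]
    have hle : |(v 2 : ℝ)| ≤ E := by nlinarith
    have : |(v 2 : ℝ)|^2 ≤ E * E := by nlinarith
    calc K * (δ / (E*E)) * |(v 2 : ℝ)|^2 ≤ K * (δ / (E*E)) * (E*E) := by gcongr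
      _ = K * δ := by field_simp
      _ ≤ C := hδ2
  rcases lt_or_gt_of_ne hq with hn | hp
  · refine ⟨-v 0, -v 1, -v 2, by omega, ?_, ?_⟩
    · push_cast
      rw [neg_sq]
      have : -(v 2 : ℝ) * b + -(v 0 : ℝ) = -A := by rw [hA]; ring
      rw [this, abs_neg]; linarith
    · push_cast
      rw [neg_sq]
      have : -(v 2 : ℝ) * a + -(v 1 : ℝ) = -B := by rw [hB]; ring
      rw [this, abs_neg]; linarith
  · refine ⟨v 0, v 1, v 2, hp, ?_, ?_⟩
    · rw [← hA]; linarith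
    · rw [← hB]; linarith

/-- **Lemma (Diophantine interpretation of `W₂^∞`).** `(a,b) ∈ W₂^∞` iff there are a
sequence `t_i → ∞` and nonzero integer vectors `v_i` with
`sup_{s∈I} ‖g_{t_i} φ_{a,b}(s) v_i‖ → 0` as `i → ∞`. -/
theorem mem_W2inf_iff_vanishing_orbit (a b s₁ s₂ : ℝ) (h : s₁ < s₂) :
    W2inf a b ↔
      ∃ (t : ℕ → ℝ) (v : ℕ → Fin 3 → ℤ),
        Tendsto t atTop atTop ∧ (∀ i, v i ≠ 0) ∧
        Tendsto (fun i => supNormOrbit a b s₁ s₂ (t i) (v i)) atTop (𝓝 0) := by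
  constructor
  · intro hW
    have H : ∀ i : ℕ, ∃ (t : ℝ) (v : Fin 3 → ℤ), Real.log (1/(1/((i:ℝ)+1))) ≤ t ∧ v ≠ 0 ∧
      supNormOrbit a b s₁ s₂ t v ≤ (2 + |a| + |s₁| + |s₂|) * (1/((i:ℝ)+1)) := fun i =>
      orbit_forward a b s₁ s₂ hW _ (by positivity) (by
        rw [div_le_one (by positivity)]; linarith [(Nat.cast_nonneg i : (0:ℝ) ≤ i)])
    choose t v h1 h2 h3 using H
    refine ⟨t, v, ?_, h2, ?_⟩
    · refine tendsto_atTop_mono h1 ?_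
      simp only [one_div_one_div]
      exact Real.tendsto_log_atTop.comp
        (tendsto_atTop_add_const_right _ _ tendsto_natCast_atTop_atTop)
    · refine squeeze_zero (fun i => Real.iSup_nonneg fun s => norm_nonneg _) h3 ?_
      simpa using (tendsto_one_div_add_atTop_nhds_zero_nat (𝕜 := ℝ)).const_mul
        (2 + |a| + |s₁| + |s₂|)
  · rintro ⟨t, v, ht, hv, hlim⟩ C hC
    obtain ⟨δ, hδ, H⟩ := orbit_backward a b s₁ s₂ h C hC
    obtain ⟨i, hi1, hi2⟩ := ((ht.eventually_ge_atTop 0).and (hlim.eventually_le_const hδ)).exists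
    exact H (t i) (v i) hi1 (hv i) hi2
end
end

section
/- For any positive integers d₁ and d₂ there exists a constant c > 0 such that for all real polynomials E₁ and E₂ with deg E₁ ≤ d₁ and deg E₂ ≤ d₂, one has sup_{x∈[0,1]} |E₁(x)E₂(x)| ≥ c · (sup_{x∈[0,1]} |E₁(x)|) · (sup_{x∈[0,1]} |E₂(x)|). -/
open Polynomial in
lemma aux_mul_ne (p q : Polynomial ℝ)
    (hp : p.toContinuousMapOn (Set.Icc (0:ℝ) 1) ≠ 0)
    (hq : q.toContinuousMapOn (Set.Icc (0:ℝ) 1) ≠ 0) :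
    p.toContinuousMapOn (Set.Icc (0:ℝ) 1) * q.toContinuousMapOn (Set.Icc (0:ℝ) 1) ≠ 0 := by
  intro h
  have hpq : p * q = 0 := by
    apply Polynomial.eq_zero_of_infinite_isRoot
    apply (Set.Icc_infinite (zero_lt_one : (0:ℝ) < 1)).mono
    intro x hx
    have := congrArg (fun f : C(Set.Icc (0:ℝ) 1, ℝ) => f ⟨x, hx⟩) h
    simpa [Polynomial.IsRoot] using this
  rcases mul_eq_zero.1 hpq with h0 | h0
  · apply hp; subst h0; ext x; simp
  · apply hq; subst h0; ext x; simp

noncomputable def auxV (d : ℕ) : Submodule ℝ C(Set.Icc (0:ℝ) 1, ℝ) :=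
  (Polynomial.degreeLT ℝ (d+1)).map
    (Polynomial.toContinuousMapOnAlgHom (R := ℝ) (Set.Icc (0:ℝ) 1)).toLinearMap

instance auxV_fin (d : ℕ) : FiniteDimensional ℝ (auxV d) := by
  have : FiniteDimensional ℝ (Polynomial.degreeLT ℝ (d+1)) :=
    Module.Finite.equiv (Polynomial.degreeLTEquiv ℝ (d+1)).symm
  unfold auxV
  infer_instance

lemma auxV_mem (d : ℕ) (p : Polynomial ℝ) (h : p.natDegree ≤ d) :
    p.toContinuousMapOn (Set.Icc (0:ℝ) 1) ∈ auxV d := by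
  refine ⟨p, ?_, rfl⟩
  rw [SetLike.mem_coe, Polynomial.mem_degreeLT]
  exact lt_of_le_of_lt Polynomial.degree_le_natDegree (by exact_mod_cast Nat.lt_succ_of_le h)

lemma auxV_mul_ne (d e : ℕ) (f : auxV d) (g : auxV e) (hf : f ≠ 0) (hg : g ≠ 0) :
    (f : C(Set.Icc (0:ℝ) 1, ℝ)) * g ≠ 0 := by
  obtain ⟨f, p, hp, rfl⟩ := f
  obtain ⟨g, q, hq, rfl⟩ := g
  exact aux_mul_ne p q (fun h => hf (Subtype.ext h)) (fun h => hg (Subtype.ext h))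

lemma auxV_bound {A : Type*} [NormedRing A] [NormedAlgebra ℝ A] (V W : Submodule ℝ A)
    [FiniteDimensional ℝ V] [FiniteDimensional ℝ W]
    (hne : ∀ (f : V) (g : W), f ≠ 0 → g ≠ 0 → (f : A) * g ≠ 0) :
    ∃ c > (0:ℝ), ∀ (f : V) (g : W), c * (‖f‖ * ‖g‖) ≤ ‖(f : A) * g‖ := by
  have hK : IsCompact (Metric.sphere (0 : V) 1 ×ˢ Metric.sphere (0 : W) 1) := by
    have := FiniteDimensional.proper ℝ V
    have := FiniteDimensional.proper ℝ W
    exact (isCompact_sphere _ _).prod (isCompact_sphere _ _)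
  have hc : Continuous (fun z : V × W => ‖(z.1 : A) * z.2‖) := by
    fun_prop
  have key : ∃ c > (0:ℝ), ∀ z ∈ Metric.sphere (0 : V) 1 ×ˢ Metric.sphere (0 : W) 1,
      c ≤ ‖(z.1 : A) * z.2‖ := by
    rcases (Metric.sphere (0 : V) 1 ×ˢ Metric.sphere (0 : W) 1).eq_empty_or_nonempty
      with h | h
    · exact ⟨1, one_pos, fun z hz => by rw [h] at hz; exact hz.elim⟩
    · obtain ⟨z, hz, hm⟩ := hK.exists_isMinOn h hc.continuousOn
      refine ⟨_, norm_pos_iff.2 (hne z.1 z.2 ?_ ?_), fun w hw => hm hw⟩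
      · exact ne_zero_of_mem_unit_sphere ⟨z.1, hz.1⟩
      · exact ne_zero_of_mem_unit_sphere ⟨z.2, hz.2⟩
  obtain ⟨c, hc0, hcb⟩ := key
  refine ⟨c, hc0, fun f g => ?_⟩
  by_cases hf : f = 0
  · rw [hf, norm_zero, zero_mul, mul_zero]; exact norm_nonneg _
  by_cases hg : g = 0
  · rw [hg, norm_zero, mul_zero, mul_zero]; exact norm_nonneg _
  have hf' : 0 < ‖f‖ := norm_pos_iff.2 hf
  have hg' : 0 < ‖g‖ := norm_pos_iff.2 hg
  have h := hcb (‖f‖⁻¹ • f, ‖g‖⁻¹ • g)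
    ⟨by rw [mem_sphere_zero_iff_norm, norm_smul, norm_inv, norm_norm, inv_mul_cancel₀ hf'.ne'],
      by rw [mem_sphere_zero_iff_norm, norm_smul, norm_inv, norm_norm, inv_mul_cancel₀ hg'.ne']⟩
  simp only [Submodule.coe_smul, smul_mul_smul_comm] at h
  rw [norm_smul, Real.norm_of_nonneg (by positivity), ← mul_inv,
    inv_mul_eq_div, le_div_iff₀ (by positivity)] at h
  exact h

/-- **Lemma (submultiplicative lower bound for sup-norms of polynomial products).**
For any positive integers `d₁, d₂` there is `c > 0` such that for all real polynomials
`E₁, E₂` with `deg E₁ ≤ d₁` and `deg E₂ ≤ d₂`,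
`sup_{x∈[0,1]} |E₁(x)E₂(x)| ≥ c · (sup_{x∈[0,1]} |E₁(x)|) · (sup_{x∈[0,1]} |E₂(x)|)`. -/
theorem polynomial_product_sup_lower_bound (d₁ d₂ : ℕ) (hd₁ : 0 < d₁) (hd₂ : 0 < d₂) :
    ∃ c > (0:ℝ), ∀ E₁ E₂ : Polynomial ℝ, E₁.natDegree ≤ d₁ → E₂.natDegree ≤ d₂ →
      c * ((⨆ x : Set.Icc (0:ℝ) 1, |E₁.eval (x : ℝ)|) *
           (⨆ x : Set.Icc (0:ℝ) 1, |E₂.eval (x : ℝ)|)) ≤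
        ⨆ x : Set.Icc (0:ℝ) 1, |E₁.eval (x : ℝ) * E₂.eval (x : ℝ)| := by
  obtain ⟨c, hc, h⟩ := auxV_bound (auxV d₁) (auxV d₂) (auxV_mul_ne d₁ d₂)
  refine ⟨c, hc, fun E₁ E₂ h₁ h₂ => ?_⟩
  have := h ⟨_, auxV_mem d₁ E₁ h₁⟩ ⟨_, auxV_mem d₂ E₂ h₂⟩
  simpa [Submodule.coe_norm, ContinuousMap.norm_eq_iSup_norm, Real.norm_eq_abs, ← abs_mul] using this
end
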